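/- Let μ, ν ∈ ℝ with μ + ν > −1 and μ − ν a nonnegative integer. If P ∈ ℂ[x] is a monic polynomial of degree 2n that is orthogonal with respect to x^μ J_ν(x) on (0,∞), then P is an even function (P(−x) = P(x)), every complex root z of P satisfies Re z = 0, and the root set of P is closed under complex conjugation. If moreover μ − ν is even and P ∈ ℂ[x] is a monic polynomial of degree 2n+1 that is orthogonal with respect to x^μ J_ν(x) on (0,∞), then P is an odd function (P(−x) = −P(x)) and every complex root z of P satisfies Re z = 0. -/

import Mathlib

open MeasureTheory Filter Set Polynomial
open scoped Classical

noncomputable section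

/-- The Abel limit of `∫₀^∞ g(x) dx` is `L`: for every `s > 0` the integral
`∫₀^∞ e^{-s x} g(x) dx` converges and these integrals tend to `L` as `s → 0⁺`. -/
def HasAbelLimit (g : ℝ → ℂ) (L : ℂ) : Prop :=
  (∀ s : ℝ, 0 < s →
    IntegrableOn (fun x : ℝ => Complex.exp (-(s : ℂ) * (x : ℂ)) * g x) (Set.Ioi 0)) ∧
  Tendsto (fun s : ℝ => ∫ x in Set.Ioi (0:ℝ), Complex.exp (-(s : ℂ) * (x : ℂ)) * g x)
    (nhdsWithin 0 (Set.Ioi 0)) (nhds L)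

/-- Bessel function of the first kind of order `ν`, for `x > 0`, with the convention
`1/Γ(z) = 0` at nonpositive integers `z` (automatic since `Real.Gamma` vanishes there). -/
def besselJ (ν x : ℝ) : ℝ :=
  ∑' k : ℕ, ((-1 : ℝ) ^ k / ((k.factorial : ℝ) * Real.Gamma (ν + k + 1))) *
    (x / 2) ^ (ν + 2 * (k : ℝ))

/-- Modified Bessel function of the second kind of order `ν`, for `x > 0`. -/
def besselK (ν x : ℝ) : ℝ :=
  ∫ t in Set.Ioi (0:ℝ), Real.exp (-x * Real.cosh t) * Real.cosh (ν * t)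

/-- The weight function `w_{μ,ν}` on `(0,∞)`. -/
def weightW (μ ν : ℝ) (x : ℝ) : ℝ :=
  if ∃ m : ℤ, μ - ν = 2 * m then (1/2) * x ^ ((μ - 1)/2) * besselK ν (Real.sqrt x)
  else (1/2) * x ^ (μ/2) * besselK ν (Real.sqrt x)

/-- `0 < x_1 < ⋯ < x_n` together with positive weights `w_1, …, w_n` form an `n`-point
Gaussian quadrature rule for `w_{μ,ν}`. -/
def IsGaussRule (μ ν : ℝ) (n : ℕ) (xs ws : Fin n → ℝ) : Prop :=
  StrictMono xs ∧ (∀ j, 0 < xs j) ∧ (∀ j, 0 < ws j) ∧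
  ∀ p : Polynomial ℝ, p.natDegree ≤ 2 * n - 1 →
    ∑ j, ws j * p.eval (xs j) = ∫ x in Set.Ioi (0:ℝ), weightW μ ν x * p.eval x

/-- `κ = μ` if `μ - ν` is even and `κ = μ + 1` if `μ - ν` is odd. -/
def kappaQ (μ ν : ℕ) : ℝ := if Even (μ - ν) then (μ : ℝ) else (μ : ℝ) + 1

/-- The boundary weights `ŵ_k⁰` of the generalized Gauss–Radau rule. -/
def wHat0 (μ ν : ℕ) {n : ℕ} (xs ws : Fin n → ℝ) (k : ℕ) : ℝ :=
  (1 / (k.factorial : ℝ)) *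
    (2 ^ k * Real.Gamma (((ν : ℝ) + k + 1)/2) / Real.Gamma (((ν : ℝ) - k + 1)/2)
      - (2 / Real.pi) * Real.cos (((k : ℝ) - ν) * Real.pi / 2) *
          ∑ j, ws j * (xs j) ^ (((k : ℝ) - kappaQ μ ν)/2))

/-- The generalized Gauss–Radau rule `(Q_{2n,μ} f)(ω)`. -/
def QRule (μ ν : ℕ) {n : ℕ} (xs ws : Fin n → ℝ) (f : ℂ → ℂ) (ω : ℝ) : ℂ :=
  (1 / (ω : ℂ)) *
    ((∑ k ∈ Finset.range μ, (wHat0 μ ν xs ws k : ℂ) / (ω : ℂ) ^ k * iteratedDeriv k f 0)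
      + ∑ j, ((ws j * (xs j) ^ (-(kappaQ μ ν)/2) / Real.pi : ℝ) : ℂ) *
          (Complex.exp (-(ν : ℂ) * (Real.pi : ℂ) * Complex.I / 2) *
              f (Complex.I * (Real.sqrt (xs j) : ℂ) / (ω : ℂ))
            + Complex.exp ((ν : ℂ) * (Real.pi : ℂ) * Complex.I / 2) *
              f (-Complex.I * (Real.sqrt (xs j) : ℂ) / (ω : ℂ))))

/-- `P` is a monic polynomial of degree `m` orthogonal with respect to `x^μ J_ν(x)`
on `(0,∞)`, all integrals taken in the Abel-limit sense. -/
def MonicOrthoBessel (μ ν : ℝ) (m : ℕ) (P : Polynomial ℂ) : Prop :=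
  P.Monic ∧ P.natDegree = m ∧
  ∀ k < m, HasAbelLimit
    (fun x : ℝ => P.eval (x : ℂ) * ((x ^ ((k : ℝ) + μ) : ℝ) : ℂ) * (besselJ ν x : ℂ)) 0

/-- `φ` is the monic real polynomial of degree `m` orthogonal to all lower powers
with respect to the weight `w_{μ,ν}` on `(0,∞)`. -/
def IsMonicOrthoW (μ ν : ℝ) (m : ℕ) (φ : Polynomial ℝ) : Prop :=
  φ.Monic ∧ φ.natDegree = m ∧
  ∀ k < m, ∫ x in Set.Ioi (0:ℝ), weightW μ ν x * φ.eval x * x ^ k = 0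


open Topology

/-- The entire function `φ_ν(y) = ∑ (-1)^k y^k / (k! Γ(ν+k+1))`. -/
def besselPhi (ν y : ℝ) : ℝ :=
  ∑' k : ℕ, ((-1 : ℝ) ^ k / ((k.factorial : ℝ) * Real.Gamma (ν + k + 1))) * y ^ k

lemma Real.inv_Gamma_eq_self_mul_inv_Gamma_add_one (s : ℝ) :
    (Real.Gamma s)⁻¹ = s * (Real.Gamma (s + 1))⁻¹ := by
  have h := Complex.one_div_Gamma_eq_self_mul_one_div_Gamma_add_one (s : ℂ)
  rw [← Complex.ofReal_one, ← Complex.ofReal_add, Complex.Gamma_ofReal, Complex.Gamma_ofReal] at h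
  exact_mod_cast h

lemma besselPhi_summable_abs (ν y : ℝ) :
    Summable fun k : ℕ =>
      |((-1 : ℝ) ^ k / ((k.factorial : ℝ) * Real.Gamma (ν + k + 1))) * y ^ k| := by
  refine Summable.abs (summable_of_ratio_norm_eventually_le (r := 1 / 2) (by norm_num) ?_)
  obtain ⟨N, hN⟩ := exists_nat_gt (max (2 * |y|) |ν|)
  filter_upwards [eventually_ge_atTop N] with k hk
  have hk' : (N : ℝ) ≤ k := by exact_mod_cast hk
  have h1 : 2 * |y| < k := lt_of_lt_of_le (lt_of_le_of_lt (le_max_left _ _) hN) hk'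
  have h2 : |ν| < k := lt_of_lt_of_le (lt_of_le_of_lt (le_max_right _ _) hN) hk'
  have h3 : 1 ≤ ν + k + 1 := by linarith [neg_abs_le ν]
  have hrec := Real.inv_Gamma_eq_self_mul_inv_Gamma_add_one (ν + k + 1)
  simp only [div_eq_mul_inv _ (_ * _), mul_inv, hrec, Nat.factorial_succ]
  push_cast
  rw [show ν + ((k : ℝ) + 1) + 1 = ν + k + 1 + 1 by ring]
  simp only [norm_mul, norm_pow, norm_neg, norm_one, one_pow, one_mul, norm_inv, Real.norm_eq_abs,
    mul_inv, pow_succ]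
  rw [abs_of_pos (show (0 : ℝ) < k + 1 by positivity), abs_of_nonneg (show 0 ≤ ν + k + 1 by linarith)]
  have h4 : ((k : ℝ) + 1)⁻¹ * |y| ≤ 1 / 2 * (ν + k + 1) := by
    rw [inv_mul_le_iff₀ (by positivity)]
    nlinarith [abs_nonneg y]
  calc _ = (((k : ℝ) + 1)⁻¹ * |y|) *
        (|(k.factorial : ℝ)|⁻¹ * |Real.Gamma (ν + k + 1 + 1)|⁻¹ * |y| ^ k) := by ring
    _ ≤ (1 / 2 * (ν + k + 1)) *
        (|(k.factorial : ℝ)|⁻¹ * |Real.Gamma (ν + k + 1 + 1)|⁻¹ * |y| ^ k) := by gcongr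
    _ = _ := by ring

lemma besselPhi_summable (ν y : ℝ) :
    Summable fun k : ℕ =>
      ((-1 : ℝ) ^ k / ((k.factorial : ℝ) * Real.Gamma (ν + k + 1))) * y ^ k :=
  (besselPhi_summable_abs ν y).of_abs

lemma besselPhi_coeff_succ (ν : ℝ) (k : ℕ) :
    ((-1 : ℝ) ^ (k + 1) / (((k + 1).factorial : ℝ) * Real.Gamma (ν + (k + 1 : ℕ) + 1))) *
        (k + 1 : ℕ) =
      -((-1 : ℝ) ^ k / ((k.factorial : ℝ) * Real.Gamma (ν + 1 + k + 1))) := by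
  rw [Nat.factorial_succ]
  push_cast
  rw [show ν + ((k : ℝ) + 1) + 1 = ν + 1 + k + 1 by ring, div_eq_mul_inv, div_eq_mul_inv]
  simp only [mul_inv, pow_succ]
  have : ((k : ℝ) + 1) ≠ 0 := by positivity
  field_simp

lemma hasDerivAt_besselPhi (ν y : ℝ) :
    HasDerivAt (besselPhi ν) (-besselPhi (ν + 1) y) y := by
  set R : ℝ := |y| + 1 with hR
  set c : ℕ → ℝ := fun k => (-1 : ℝ) ^ k / ((k.factorial : ℝ) * Real.Gamma (ν + k + 1)) with hc
  have hterm : ∀ (z : ℝ) (k : ℕ), c (k + 1) * ((k + 1 : ℕ) * z ^ k) =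
      -(((-1 : ℝ) ^ k / ((k.factorial : ℝ) * Real.Gamma (ν + 1 + k + 1))) * z ^ k) := by
    intro z k
    rw [← mul_assoc, besselPhi_coeff_succ, neg_mul]
  have hu : Summable fun k : ℕ => |c k * (k * R ^ (k - 1))| := by
    rw [← summable_nat_add_iff 1]
    simpa only [Nat.add_sub_cancel, hterm, abs_neg] using besselPhi_summable_abs (ν + 1) R
  have hy : y ∈ Metric.ball (0 : ℝ) R := by simp [hR]
  have key := hasDerivAt_tsum_of_isPreconnected (g := fun k z => c k * z ^ k)
    (g' := fun k z => c k * (k * z ^ (k - 1))) hu Metric.isOpen_ball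
    (convex_ball (0 : ℝ) R).isPreconnected
    (fun k z _ => (hasDerivAt_pow k z).const_mul (c k))
    (fun k z hz => by
      have hz' : |z| ≤ R := by simpa using (Metric.mem_ball.1 hz).le
      have hR' : |z| ≤ |R| := hz'.trans (le_abs_self R)
      rw [Real.norm_eq_abs, abs_mul, abs_mul, abs_mul, abs_mul, abs_pow, abs_pow]
      gcongr) hy (besselPhi_summable ν y) hy
  have hsum : ∑' k : ℕ, c k * (k * y ^ (k - 1)) = -besselPhi (ν + 1) y := by
    have hs : Summable fun k : ℕ => c k * (k * y ^ (k - 1)) := by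
      rw [← summable_nat_add_iff 1]
      simpa only [Nat.add_sub_cancel, hterm] using (besselPhi_summable (ν + 1) y).neg
    rw [hs.tsum_eq_zero_add]
    simp only [Nat.add_sub_cancel, hterm, tsum_neg]
    simp [besselPhi]
  rw [hsum] at key
  exact key

lemma besselPhi_recurrence (ν y : ℝ) :
    besselPhi ν y = (ν + 1) * besselPhi (ν + 1) y - y * besselPhi (ν + 2) y := by
  have h0 := besselPhi_summable (ν + 1) y
  have h2 := besselPhi_summable (ν + 2) y
  have h1 : ∀ k : ℕ, ((-1 : ℝ) ^ k / ((k.factorial : ℝ) * Real.Gamma (ν + k + 1))) * y ^ k =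
      (ν + 1) * (((-1 : ℝ) ^ k / ((k.factorial : ℝ) * Real.Gamma (ν + 1 + k + 1))) * y ^ k) +
      k * (((-1 : ℝ) ^ k / ((k.factorial : ℝ) * Real.Gamma (ν + 1 + k + 1))) * y ^ k) := by
    intro k
    have hrec := Real.inv_Gamma_eq_self_mul_inv_Gamma_add_one (ν + k + 1)
    rw [show ν + k + 1 + 1 = ν + 1 + k + 1 by ring] at hrec
    simp only [div_eq_mul_inv, mul_inv, hrec]
    ring
  have hterm : ∀ k : ℕ, ((k + 1 : ℕ) : ℝ) * (((-1 : ℝ) ^ (k + 1) /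
      (((k + 1).factorial : ℝ) * Real.Gamma (ν + 1 + (k + 1 : ℕ) + 1))) * y ^ (k + 1)) =
      -y * (((-1 : ℝ) ^ k / ((k.factorial : ℝ) * Real.Gamma (ν + 2 + k + 1))) * y ^ k) := by
    intro k
    have := besselPhi_coeff_succ (ν + 1) k
    rw [show ν + 1 + 1 = ν + 2 by ring] at this
    rw [← mul_assoc, mul_comm ((k + 1 : ℕ) : ℝ), this]
    ring
  have hs : Summable fun k : ℕ => (k : ℝ) *
      (((-1 : ℝ) ^ k / ((k.factorial : ℝ) * Real.Gamma (ν + 1 + k + 1))) * y ^ k) := by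
    rw [← summable_nat_add_iff 1]
    simpa only [hterm] using h2.mul_left (-y)
  unfold besselPhi
  rw [tsum_congr h1, (h0.mul_left _).tsum_add hs, tsum_mul_left, hs.tsum_eq_zero_add]
  simp only [hterm, tsum_mul_left]
  simp
  ring

/-- The even entire function `x ↦ (x/2)^{-ν} J_ν(x)`. -/
def besselEntire (ν x : ℝ) : ℝ := besselPhi ν (x ^ 2 / 4)

lemma besselJ_eq (ν : ℝ) {x : ℝ} (hx : 0 < x) :
    besselJ ν x = (x / 2) ^ ν * besselEntire ν x := by
  unfold besselJ besselEntire besselPhi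
  rw [← tsum_mul_left]
  refine tsum_congr fun k => ?_
  rw [Real.rpow_add (by positivity), Real.rpow_mul (by positivity), Real.rpow_natCast,
    Real.rpow_two, show x ^ 2 / 4 = (x / 2) ^ 2 by ring]
  ring

lemma hasDerivAt_besselEntire (ν x : ℝ) :
    HasDerivAt (besselEntire ν) (-(x / 2) * besselEntire (ν + 1) x) x := by
  have h : HasDerivAt (fun x : ℝ => x ^ 2 / 4) (x / 2) x := by
    convert! (hasDerivAt_pow 2 x).div_const 4 using 1
    simp; ring
  convert! (hasDerivAt_besselPhi ν (x ^ 2 / 4)).comp x h using 1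
  simp only [besselEntire]; ring

lemma continuous_besselEntire (ν : ℝ) : Continuous (besselEntire ν) :=
  continuous_iff_continuousAt.2 fun x => (hasDerivAt_besselEntire ν x).continuousAt

lemma besselEntire_recurrence (ν x : ℝ) :
    besselEntire ν x =
      (ν + 1) * besselEntire (ν + 1) x - x ^ 2 / 4 * besselEntire (ν + 2) x :=
  besselPhi_recurrence ν _

lemma besselEntire_zero (ν : ℝ) : besselEntire ν 0 = (Real.Gamma (ν + 1))⁻¹ := by
  unfold besselEntire besselPhi
  rw [tsum_eq_single 0 (fun k hk => by simp [hk])]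
  simp

/-- The energy `f² + f'²` of `f = besselEntire ν` decreases on `[0, ∞)`. -/
lemma abs_besselEntire_le {ν x : ℝ} (hν : -(1 / 2) ≤ ν) (hx : 0 ≤ x) :
    |besselEntire ν x| ≤ |besselEntire ν 0| := by
  set E : ℝ → ℝ := fun x => besselEntire ν x ^ 2 + (x / 2 * besselEntire (ν + 1) x) ^ 2 with hE
  have hd : ∀ x, HasDerivAt E (-((2 * ν + 1) * (x / 2) * besselEntire (ν + 1) x ^ 2)) x := by
    intro x
    have h1 := (hasDerivAt_besselEntire ν x).pow 2
    have h2 := ((((hasDerivAt_id x).div_const 2).mul (hasDerivAt_besselEntire (ν + 1) x)).pow 2)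
    convert! h1.add h2 using 1
    have h3 := besselEntire_recurrence ν x
    rw [show ν + 1 + 1 = ν + 2 by ring]
    simp
    rw [h3]
    ring
  have hanti : AntitoneOn E (Ici 0) := by
    refine antitoneOn_of_deriv_nonpos (convex_Ici 0)
      (fun x _ => (hd x).continuousAt.continuousWithinAt)
      (fun x _ => (hd x).differentiableAt.differentiableWithinAt) fun x hx => ?_
    rw [interior_Ici, mem_Ioi] at hx
    rw [(hd x).deriv]
    have : 0 ≤ (2 * ν + 1) * (x / 2) * besselEntire (ν + 1) x ^ 2 := by
      have : 0 ≤ 2 * ν + 1 := by linarith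
      positivity
    linarith
  have h := hanti (mem_Ici.2 le_rfl) (mem_Ici.2 hx) hx
  simp only [hE] at h
  refine sq_le_sq.1 ?_
  nlinarith [sq_nonneg (x / 2 * besselEntire (ν + 1) x)]

lemma exists_abs_besselEntire_le_exp (ν : ℝ) {ε : ℝ} (hε : 0 < ε) :
    ∃ C, ∀ x, 0 ≤ x → |besselEntire ν x| ≤ C * Real.exp (ε * x) := by
  obtain ⟨n, hn⟩ := exists_nat_gt (-(1 / 2) - ν)
  replace hn : -(1 / 2) ≤ ν + n := by linarith
  induction n generalizing ν ε with
  | zero =>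
    refine ⟨|besselEntire ν 0|, fun x hx => (abs_besselEntire_le (by simpa using hn) hx).trans ?_⟩
    exact le_mul_of_one_le_right (abs_nonneg _) (Real.one_le_exp (by positivity))
  | succ n ih =>
    push_cast at hn
    obtain ⟨C₁, h₁⟩ := ih (ν + 1) hε (by linarith)
    obtain ⟨C₂, h₂⟩ := ih (ν + 2) (half_pos hε) (by linarith)
    refine ⟨|ν + 1| * C₁ + 2 / ε ^ 2 * C₂, fun x hx => ?_⟩
    have hq := Real.quadratic_le_exp_of_nonneg (x := ε / 2 * x) (by positivity)
    have hsq : x ^ 2 / 4 ≤ 2 / ε ^ 2 * Real.exp (ε / 2 * x) := by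
      rw [div_mul_eq_mul_div, le_div_iff₀ (by positivity)]
      have : 0 ≤ ε / 2 * x := by positivity
      nlinarith
    rw [besselEntire_recurrence]
    calc _ ≤ |ν + 1| * |besselEntire (ν + 1) x| + x ^ 2 / 4 * |besselEntire (ν + 2) x| := by
          refine (abs_sub _ _).trans ?_
          rw [abs_mul, abs_mul, abs_of_nonneg (show 0 ≤ x ^ 2 / 4 by positivity)]
      _ ≤ |ν + 1| * (C₁ * Real.exp (ε * x)) +
          2 / ε ^ 2 * Real.exp (ε / 2 * x) * (C₂ * Real.exp (ε / 2 * x)) := by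
          gcongr
          exacts [h₁ x hx, h₂ x hx]
      _ = _ := by
          rw [show ε * x = ε / 2 * x + ε / 2 * x by ring, Real.exp_add]
          ring

/-- The Laplace transform of `x ^ p * besselEntire ν x`. -/
def besselLaplace (p ν s : ℝ) : ℝ :=
  ∫ x in Ioi (0 : ℝ), Real.exp (-s * x) * (x ^ p * besselEntire ν x)

lemma integrableOn_rpow_mul_exp_neg_mul {p b : ℝ} (hp : -1 < p) (hb : 0 < b) :
    IntegrableOn (fun x : ℝ => x ^ p * Real.exp (-b * x)) (Ioi 0) := by
  simpa using integrableOn_rpow_mul_exp_neg_mul_rpow hp one_pos hb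

lemma integrableOn_besselLaplace {p s : ℝ} (ν : ℝ) (hp : -1 < p) (hs : 0 < s) :
    IntegrableOn (fun x : ℝ => Real.exp (-s * x) * (x ^ p * besselEntire ν x)) (Ioi 0) := by
  obtain ⟨C, hC⟩ := exists_abs_besselEntire_le_exp ν (half_pos hs)
  refine Integrable.mono' ((integrableOn_rpow_mul_exp_neg_mul hp (half_pos hs)).const_mul C) ?_ ?_
  · refine ContinuousOn.aestronglyMeasurable (fun x hx => ?_) measurableSet_Ioi
    have hx' : x ≠ 0 := (mem_Ioi.1 hx).ne'
    have := (continuous_besselEntire ν).continuousAt (x := x)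
    have := Real.continuousAt_rpow_const x p (Or.inl hx')
    exact ContinuousAt.continuousWithinAt (by fun_prop)
  · refine (ae_restrict_iff' measurableSet_Ioi).2 (ae_of_all _ fun x hx => ?_)
    have hx0 : 0 < x := hx
    have hpow := Real.rpow_nonneg hx0.le p
    rw [Real.norm_eq_abs, abs_mul, abs_mul, abs_of_nonneg hpow, abs_of_pos (Real.exp_pos _)]
    calc _ ≤ Real.exp (-s * x) * (x ^ p * (C * Real.exp (s / 2 * x))) := by
          gcongr
          exact hC x hx0.le
      _ = C * (x ^ p * (Real.exp (-s * x) * Real.exp (s / 2 * x))) := by ring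
      _ = _ := by rw [← Real.exp_add]; ring_nf

lemma besselLaplace_by_parts {p s : ℝ} (ν : ℝ) (hp : 0 < p) (hs : 0 < s) :
    p * besselLaplace (p - 1) ν s - besselLaplace (p + 1) (ν + 1) s / 2 =
      s * besselLaplace p ν s := by
  have i1 := (integrableOn_besselLaplace ν (p := p - 1) (by linarith) hs).const_mul p
  have i2 := (integrableOn_besselLaplace (ν + 1) (p := p + 1) (by linarith) hs).div_const 2
  have i3 := (integrableOn_besselLaplace ν (p := p) (by linarith) hs).const_mul s
  have hcont : Continuous fun x : ℝ => Real.exp (-s * x) * (x ^ p * besselEntire ν x) := by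
    have := continuous_besselEntire ν
    have := Real.continuous_rpow_const hp.le
    fun_prop
  have hderiv : ∀ x ∈ Ioi (0 : ℝ), HasDerivAt
      (fun x : ℝ => Real.exp (-s * x) * (x ^ p * besselEntire ν x))
      (p * (Real.exp (-s * x) * (x ^ (p - 1) * besselEntire ν x)) -
        Real.exp (-s * x) * (x ^ (p + 1) * besselEntire (ν + 1) x) / 2 -
        s * (Real.exp (-s * x) * (x ^ p * besselEntire ν x))) x := by
    intro x hx
    have hx0 : 0 < x := hx
    have h1 : HasDerivAt (fun x : ℝ => Real.exp (-s * x)) (Real.exp (-s * x) * (-s)) x := by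
      simpa using ((hasDerivAt_id x).const_mul (-s)).exp
    have h2 := Real.hasDerivAt_rpow_const (x := x) (p := p) (Or.inl hx0.ne')
    convert! h1.mul (h2.mul (hasDerivAt_besselEntire ν x)) using 1
    rw [Real.rpow_add_one hx0.ne']
    simp only [Pi.mul_apply]
    ring
  have hlim : Tendsto (fun x : ℝ => Real.exp (-s * x) * (x ^ p * besselEntire ν x)) atTop (𝓝 0) := by
    obtain ⟨C, hC⟩ := exists_abs_besselEntire_le_exp ν (half_pos hs)
    have ht := (tendsto_rpow_mul_exp_neg_mul_atTop_nhds_zero p (s / 2) (half_pos hs)).const_mul C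
    rw [mul_zero] at ht
    refine squeeze_zero_norm' ?_ ht
    filter_upwards [eventually_gt_atTop 0] with x hx0
    have hpow := Real.rpow_nonneg hx0.le p
    rw [Real.norm_eq_abs, abs_mul, abs_mul, abs_of_nonneg hpow, abs_of_pos (Real.exp_pos _)]
    calc _ ≤ Real.exp (-s * x) * (x ^ p * (C * Real.exp (s / 2 * x))) := by
          gcongr
          exact hC x hx0.le
      _ = C * (x ^ p * (Real.exp (-s * x) * Real.exp (s / 2 * x))) := by ring
      _ = _ := by rw [← Real.exp_add]; ring_nf
  have key := integral_Ioi_of_hasDerivAt_of_tendsto hcont.continuousWithinAt hderiv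
    ((i1.sub i2).sub i3) hlim
  have hsub := integral_sub (i1.sub i2) i3
  simp only [Pi.sub_apply] at hsub
  rw [hsub, integral_sub i1 i2, integral_const_mul, integral_const_mul,
    integral_div, Real.zero_rpow hp.ne'] at key
  simp only [zero_mul, mul_zero, sub_zero] at key
  exact sub_eq_zero.1 key

lemma besselLaplace_lower {q s : ℝ} (ν : ℝ) (hq : -1 < q) (hs : 0 < s) :
    2 * besselLaplace q ν s =
      s * besselLaplace (q + 1) (ν + 1) s - (q - 2 * ν - 1) * besselLaplace q (ν + 1) s := by
  have hrec : besselLaplace q ν s =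
      (ν + 1) * besselLaplace q (ν + 1) s - besselLaplace (q + 2) (ν + 2) s / 4 := by
    have i1 := (integrableOn_besselLaplace (ν + 1) hq hs).const_mul (ν + 1)
    have i2 := (integrableOn_besselLaplace (ν + 2) (p := q + 2) (by linarith) hs).div_const 4
    unfold besselLaplace
    rw [← integral_const_mul, ← integral_div, ← integral_sub i1 i2]
    refine setIntegral_congr_fun measurableSet_Ioi fun x hx => ?_
    have hx0 : 0 < x := hx
    rw [besselEntire_recurrence, Real.rpow_add hx0, Real.rpow_two]
    ring
  have hparts := besselLaplace_by_parts (ν + 1) (p := q + 1) (by linarith) hs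
  rw [show q + 1 - 1 = q by ring, show q + 1 + 1 = q + 2 by ring,
    show ν + 1 + 1 = ν + 2 by ring] at hparts
  linarith

lemma hasDerivAt_besselLaplace {p s : ℝ} (ν : ℝ) (hp : -1 < p) (hs : 0 < s) :
    HasDerivAt (besselLaplace p ν) (-besselLaplace (p + 1) ν s) s := by
  have hmem : Ioi (s / 2) ∈ 𝓝 s := Ioi_mem_nhds (by linarith)
  have hbound := (integrableOn_besselLaplace ν (p := p + 1) (by linarith) (half_pos hs)).norm
  have h := hasDerivAt_integral_of_dominated_loc_of_deriv_le (μ := volume.restrict (Ioi (0 : ℝ)))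
    (F := fun t x => Real.exp (-t * x) * (x ^ p * besselEntire ν x))
    (F' := fun t x => -(Real.exp (-t * x) * (x ^ (p + 1) * besselEntire ν x)))
    (x₀ := s) hmem ?_ (integrableOn_besselLaplace ν hp hs)
    (integrableOn_besselLaplace ν (p := p + 1) (by linarith) hs).neg.aestronglyMeasurable
    ?_ hbound ?_
  · have := h.2
    rw [integral_neg] at this
    exact this
  · filter_upwards [hmem] with t ht
    exact (integrableOn_besselLaplace ν hp (by linarith [mem_Ioi.1 ht])).aestronglyMeasurable
  · refine (ae_restrict_iff' measurableSet_Ioi).2 (ae_of_all _ fun x hx t ht => ?_)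
    have hx0 : 0 < x := hx
    rw [norm_neg, norm_mul, norm_mul (Real.exp _), Real.norm_of_nonneg (Real.exp_pos (-t * x)).le,
      Real.norm_of_nonneg (Real.exp_pos (-(s / 2) * x)).le]
    have ht' : s / 2 < t := ht
    gcongr
  · refine (ae_restrict_iff' measurableSet_Ioi).2 (ae_of_all _ fun x hx t _ => ?_)
    have hx0 : 0 < x := hx
    have h1 : HasDerivAt (fun t : ℝ => Real.exp (-t * x)) (Real.exp (-t * x) * (-x)) t := by
      simpa using ((hasDerivAt_neg t).mul_const x).exp
    convert! h1.mul_const (x ^ p * besselEntire ν x) using 1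
    rw [Real.rpow_add_one hx0.ne']
    ring

/-- The Laplace transform of `x ^ (2 ν) * besselEntire ν x` is a nonzero multiple of
`(1 + s²) ^ (-ν - 1/2)`. -/
lemma exists_besselLaplace_eq {ν : ℝ} (hν : 0 < 2 * ν + 1) :
    ∃ C : ℝ, C ≠ 0 ∧ ∀ s, 0 < s → besselLaplace (2 * ν) ν s = C * (1 + s ^ 2) ^ (-(ν + 1 / 2)) := by
  set H : ℝ → ℝ := fun s => (1 + s ^ 2) ^ (ν + 1 / 2) * besselLaplace (2 * ν) ν s with hH
  have hd : ∀ s, 0 < s → HasDerivAt H 0 s := by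
    intro s hs
    have hpos : 0 < 1 + s ^ 2 := by positivity
    have h1 := besselLaplace_by_parts ν hν hs
    have h2 := besselLaplace_lower ν (q := 2 * ν + 1) (by linarith) hs
    rw [show 2 * ν + 1 - 1 = 2 * ν by ring] at h1
    rw [show 2 * ν + 1 - 2 * ν - 1 = 0 by ring, zero_mul, sub_zero] at h2
    have h3 : (1 + s ^ 2) * besselLaplace (2 * ν + 1) ν s =
        (2 * ν + 1) * s * besselLaplace (2 * ν) ν s := by linear_combination (-s) * h1 + h2 / 2
    have h4 : HasDerivAt (fun s : ℝ => 1 + s ^ 2) (2 * s) s := by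
      simpa using (hasDerivAt_pow 2 s).const_add 1
    have h5 := (h4.rpow_const (p := ν + 1 / 2) (Or.inl hpos.ne')).mul
      (hasDerivAt_besselLaplace ν (p := 2 * ν) (by linarith) hs)
    convert! h5 using 1
    have h6 : (1 + s ^ 2) ^ (ν + 1 / 2) = (1 + s ^ 2) ^ (ν + 1 / 2 - 1) * (1 + s ^ 2) := by
      rw [← Real.rpow_add_one hpos.ne']; ring_nf
    rw [h6]
    linear_combination ((1 + s ^ 2) ^ (ν + 1 / 2 - 1)) * h3
  have hconst : ∀ s, 0 < s → H s = H 1 := fun s hs =>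
    isOpen_Ioi.is_const_of_deriv_eq_zero isPreconnected_Ioi
      (fun t ht => (hd t ht).differentiableAt.differentiableWithinAt)
      (fun t ht => (hd t ht).deriv) hs (mem_Ioi.2 one_pos)
  have hform : ∀ s, 0 < s → besselLaplace (2 * ν) ν s = H 1 * (1 + s ^ 2) ^ (-(ν + 1 / 2)) := by
    intro s hs
    have hpos : 0 < 1 + s ^ 2 := by positivity
    rw [← hconst s hs, Real.rpow_neg hpos.le]
    have := (Real.rpow_pos_of_pos hpos (ν + 1 / 2)).ne'
    simp only [hH]
    field_simp
  refine ⟨H 1, fun h0 => ?_, hform⟩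
  have hzero : ∀ s, 0 < s →
      ∫ y in Ioi (0 : ℝ), Real.exp (-y) * (y ^ (2 * ν) * besselEntire ν (s⁻¹ * y)) = 0 := by
    intro s hs
    have h1 := integral_comp_mul_left_Ioi
      (fun x : ℝ => Real.exp (-s * x) * (x ^ (2 * ν) * besselEntire ν x)) 0 (inv_pos.2 hs)
    have h2 := hform s hs
    rw [h0, zero_mul] at h2
    rw [mul_zero] at h1
    unfold besselLaplace at h2
    rw [h2, smul_zero] at h1
    have h3 : ∫ y in Ioi (0 : ℝ), Real.exp (-y) * (y ^ (2 * ν) * besselEntire ν (s⁻¹ * y)) =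
        ∫ y in Ioi (0 : ℝ), s ^ (2 * ν) * (Real.exp (-s * (s⁻¹ * y)) *
          ((s⁻¹ * y) ^ (2 * ν) * besselEntire ν (s⁻¹ * y))) := by
      refine setIntegral_congr_fun measurableSet_Ioi fun y hy => ?_
      have hy0 : 0 < y := hy
      have hsp := (Real.rpow_pos_of_pos hs (2 * ν)).ne'
      rw [Real.mul_rpow (inv_pos.2 hs).le hy0.le, Real.inv_rpow hs.le,
        show -s * (s⁻¹ * y) = -y by field_simp]
      field_simp
    rw [h3, integral_const_mul, h1, mul_zero]
  have hint := integrableOn_rpow_mul_exp_neg_mul (p := 2 * ν) (by linarith) one_pos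
  have hlim : Tendsto (fun s : ℝ => ∫ y in Ioi (0 : ℝ),
      Real.exp (-y) * (y ^ (2 * ν) * besselEntire ν (s⁻¹ * y))) atTop
      (𝓝 (∫ y in Ioi (0 : ℝ), Real.exp (-y) * (y ^ (2 * ν) * besselEntire ν 0))) := by
    refine tendsto_integral_filter_of_dominated_convergence
      (fun y => |besselEntire ν 0| * (y ^ (2 * ν) * Real.exp (-1 * y))) ?_ ?_
      (hint.const_mul _) ?_
    · refine Eventually.of_forall fun s =>
        ContinuousOn.aestronglyMeasurable (fun x hx => ?_) measurableSet_Ioi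
      have hx' : x ≠ 0 := (mem_Ioi.1 hx).ne'
      have := continuous_besselEntire ν
      have := Real.continuousAt_rpow_const x (2 * ν) (Or.inl hx')
      exact ContinuousAt.continuousWithinAt (by fun_prop)
    · filter_upwards [eventually_gt_atTop 0] with s hs
      refine (ae_restrict_iff' measurableSet_Ioi).2 (ae_of_all _ fun x hx => ?_)
      have hx0 : 0 < x := hx
      have hpow := Real.rpow_nonneg hx0.le (2 * ν)
      rw [Real.norm_eq_abs, abs_mul, abs_mul, abs_of_nonneg hpow, abs_of_pos (Real.exp_pos _)]
      have hle := abs_besselEntire_le (ν := ν) (x := s⁻¹ * x) (by linarith) (by positivity)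
      calc _ ≤ Real.exp (-x) * (x ^ (2 * ν) * |besselEntire ν 0|) := by gcongr
        _ = _ := by rw [neg_one_mul]; ring
    · refine ae_of_all _ fun y => ?_
      have h1 : Tendsto (fun s : ℝ => s⁻¹ * y) atTop (𝓝 0) := by
        simpa using tendsto_inv_atTop_zero.mul_const y
      exact ((((continuous_besselEntire ν).tendsto 0).comp h1).const_mul _).const_mul _
  have hlim0 := hlim.congr' (by
    filter_upwards [eventually_gt_atTop 0] with s hs using hzero s hs)
  have hval := tendsto_nhds_unique hlim0 tendsto_const_nhds
  simp only [← mul_assoc] at hval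
  rw [integral_mul_const] at hval
  have hG : ∫ y in Ioi (0 : ℝ), Real.exp (-y) * y ^ (2 * ν) = Real.Gamma (2 * ν + 1) := by
    rw [Real.Gamma_eq_integral hν]
    simp
  rw [hG, besselEntire_zero] at hval
  have g1 := Real.Gamma_pos_of_pos hν
  have g2 := Real.Gamma_pos_of_pos (s := ν + 1) (by linarith)
  exact (mul_pos g1 (inv_pos.2 g2)).ne' hval

lemma exists_tendsto_besselLaplace (M : ℕ) (ν : ℝ) (h : 0 < 2 * ν + M + 1) :
    ∃ L, Tendsto (besselLaplace (2 * ν + M) ν) (𝓝[>] 0) (𝓝 L) ∧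
      (Odd M → L = 0) ∧ (Even M → L ≠ 0) := by
  have hs0 : Tendsto (fun s : ℝ => s) (𝓝[>] 0) (𝓝 0) := tendsto_id.mono_left nhdsWithin_le_nhds
  induction M using Nat.strong_induction_on generalizing ν with
  | _ M ih =>
  match M with
  | 0 =>
    rw [Nat.cast_zero, add_zero] at h ⊢
    obtain ⟨C, hC, hform⟩ := exists_besselLaplace_eq h
    refine ⟨C, ?_, by simp, fun _ => hC⟩
    have hcont : ContinuousAt (fun s : ℝ => C * (1 + s ^ 2) ^ (-(ν + 1 / 2))) 0 := by
      have : ContinuousAt (fun s : ℝ => (1 + s ^ 2) ^ (-(ν + 1 / 2))) 0 :=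
        ContinuousAt.rpow_const (by fun_prop) (Or.inl (by norm_num))
      fun_prop
    have ht := hcont.tendsto.mono_left (nhdsWithin_le_nhds (s := Ioi 0))
    simp only [ne_eq, OfNat.ofNat_ne_zero, not_false_eq_true, zero_pow, add_zero, Real.one_rpow,
      mul_one] at ht
    refine ht.congr' ?_
    filter_upwards [self_mem_nhdsWithin] with s hs using (hform s hs).symm
  | 1 =>
    rw [Nat.cast_one] at h ⊢
    obtain ⟨L, hL, -, -⟩ := ih 0 (by norm_num) (ν + 1) (by push_cast; linarith)
    rw [Nat.cast_zero, add_zero] at hL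
    refine ⟨0, ?_, fun _ => rfl, fun h => by simp at h⟩
    have ht := (hs0.mul hL).div_const 2
    rw [zero_mul, zero_div] at ht
    refine ht.congr' ?_
    filter_upwards [self_mem_nhdsWithin] with s hs
    have h2 := besselLaplace_lower ν (q := 2 * ν + 1) (by linarith) hs
    rw [show 2 * ν + 1 - 2 * ν - 1 = 0 by ring, zero_mul, sub_zero,
      show 2 * ν + 1 + 1 = 2 * (ν + 1) by ring] at h2
    linear_combination -h2 / 2
  | M + 2 =>
    push_cast at h
    obtain ⟨L₁, hL₁, -, -⟩ := ih (M + 1) (by lia) (ν + 1) (by push_cast; linarith)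
    obtain ⟨L₀, hL₀, hodd, heven⟩ := ih M (by lia) (ν + 1) (by linarith)
    refine ⟨-((M + 1) * L₀ / 2), ?_, fun ho => ?_, fun he => ?_⟩
    · have ht := ((hs0.mul hL₁).sub (hL₀.const_mul ((M : ℝ) + 1))).div_const 2
      rw [zero_mul, zero_sub, neg_div] at ht
      refine ht.congr' ?_
      filter_upwards [self_mem_nhdsWithin] with s hs
      have h2 := besselLaplace_lower ν (q := 2 * ν + (M + 2 : ℕ)) (by push_cast; linarith) hs
      rw [show 2 * ν + (M + 2 : ℕ) + 1 = 2 * (ν + 1) + (M + 1 : ℕ) by push_cast; ring,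
        show besselLaplace (2 * ν + (M + 2 : ℕ)) (ν + 1) s =
          besselLaplace (2 * (ν + 1) + M) (ν + 1) s by congr 1; push_cast; ring] at h2
      push_cast at h2 ⊢
      linear_combination -h2 / 2
    · rw [hodd (by simpa [parity_simps] using ho)]; simp
    · have := heven (by simpa [parity_simps] using he)
      have hM : (M : ℝ) + 1 ≠ 0 := by positivity
      simp [this, hM]

/-- The regularized moment `lim_{s → 0⁺} ∫ e^{-sx} x^{2ν+M} besselEntire ν x dx`. -/
def besselMoment (ν : ℝ) (M : ℕ) : ℝ := limUnder (𝓝[>] 0) (besselLaplace (2 * ν + M) ν)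

lemma besselMoment_spec {M : ℕ} {ν : ℝ} (h : 0 < 2 * ν + M + 1) :
    Tendsto (besselLaplace (2 * ν + M) ν) (𝓝[>] 0) (𝓝 (besselMoment ν M)) ∧
      (Odd M → besselMoment ν M = 0) ∧ (Even M → besselMoment ν M ≠ 0) := by
  obtain ⟨L, hL, hrest⟩ := exists_tendsto_besselLaplace M ν h
  have : besselMoment ν M = L := hL.limUnder_eq
  rw [this]
  exact ⟨hL, hrest⟩

lemma besselMoment_add_two {M : ℕ} {ν : ℝ} (h : 0 < 2 * ν + M + 1) :
    besselMoment ν (M + 2) = -((M + 1) * (2 * ν + M + 1)) * besselMoment ν M := by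
  have hs0 : Tendsto (fun s : ℝ => s) (𝓝[>] 0) (𝓝 0) := tendsto_id.mono_left nhdsWithin_le_nhds
  have t0 := (besselMoment_spec h).1
  have t1 := (besselMoment_spec (M := M + 1) (ν := ν) (by push_cast; linarith)).1
  have t2 := (besselMoment_spec (M := M + 2) (ν := ν) (by push_cast; linarith)).1
  have u0 := (besselMoment_spec (M := M) (ν := ν + 1) (by linarith)).1
  have u1 := (besselMoment_spec (M := M + 1) (ν := ν + 1) (by push_cast; linarith)).1
  have e1 : (2 * ν + M + 1) * besselMoment ν M - besselMoment (ν + 1) M / 2 = 0 := by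
    refine tendsto_nhds_unique ((t0.const_mul _).sub (u0.div_const 2)) ?_
    have ht := hs0.mul t1
    rw [zero_mul] at ht
    refine ht.congr' ?_
    filter_upwards [self_mem_nhdsWithin] with s hs
    have h1 := besselLaplace_by_parts ν h hs
    rw [show 2 * ν + M + 1 - 1 = 2 * ν + M by ring,
      show 2 * ν + M + 1 + 1 = 2 * (ν + 1) + M by ring] at h1
    rw [h1]
    push_cast
    ring_nf
  have e2 : 2 * besselMoment ν (M + 2) = -((M + 1) * besselMoment (ν + 1) M) := by
    refine tendsto_nhds_unique (t2.const_mul 2) ?_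
    have ht := (hs0.mul u1).sub (u0.const_mul ((M : ℝ) + 1))
    rw [zero_mul, zero_sub] at ht
    refine ht.congr' ?_
    filter_upwards [self_mem_nhdsWithin] with s hs
    have h2 := besselLaplace_lower ν (q := 2 * ν + (M + 2 : ℕ)) (by push_cast; linarith) hs
    rw [show 2 * ν + (M + 2 : ℕ) + 1 = 2 * (ν + 1) + (M + 1 : ℕ) by push_cast; ring,
      show besselLaplace (2 * ν + (M + 2 : ℕ)) (ν + 1) s =
        besselLaplace (2 * (ν + 1) + M) (ν + 1) s by congr 1; push_cast; ring] at h2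
    push_cast at h2 ⊢
    linear_combination -h2
  linear_combination e2 / 2 + ((M : ℝ) + 1) * e1

lemma integrable_complex_ofReal {Ω : Type*} [MeasurableSpace Ω] {m : Measure Ω} {f : Ω → ℝ}
    (hf : Integrable f m) : Integrable (fun ω => (f ω : ℂ)) m :=
  hf.ofReal

section WeightedOrthogonality

variable {Ω : Type*} [MeasurableSpace Ω] {m : Measure Ω} {W t : Ω → ℝ}

lemma integrable_weight_mul_eval_mul_eval (hint : ∀ i : ℕ, Integrable (fun ω => W ω * t ω ^ i) m)
    (Q R : ℂ[X]) :
    Integrable (fun ω => (W ω : ℂ) * (Q.eval (t ω : ℂ) * R.eval (t ω : ℂ))) m := by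
  simp only [← eval_mul]
  generalize Q * R = f
  induction f using Polynomial.induction_on' with
  | add p q hp hq => simpa only [eval_add, mul_add] using! hp.add hq
  | monomial i a =>
    refine ((integrable_complex_ofReal (hint i)).mul_const a).congr (ae_of_all _ fun ω => ?_)
    simp only [eval_monomial]
    push_cast
    ring

/-- A polynomial orthogonal to the powers below `d` is orthogonal to all polynomials of degree
less than `d`. -/
lemma integral_weight_mul_eval_mul_eval_eq_zero
    (hint : ∀ i : ℕ, Integrable (fun ω => W ω * t ω ^ i) m) {Q : ℂ[X]} {N d : ℕ}
    (hN : Q.natDegree < N)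
    (horth : ∀ k < d, ∑ i ∈ Finset.range N,
      Q.coeff i * ((∫ ω, W ω * t ω ^ (i + k) ∂m : ℝ) : ℂ) = 0)
    {R : ℂ[X]} (hR : R.degree < d) :
    ∫ ω, (W ω : ℂ) * (Q.eval (t ω : ℂ) * R.eval (t ω : ℂ)) ∂m = 0 := by
  rcases eq_or_ne R 0 with rfl | hR0
  · simp
  have hRd : R.natDegree < d := (natDegree_lt_iff_degree_lt hR0).2 hR
  have hpow : ∀ k < d, ∫ ω, (W ω : ℂ) * (Q.eval (t ω : ℂ) * (t ω : ℂ) ^ k) ∂m = 0 := by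
    intro k hk
    rw [← horth k hk]
    have hexp : ∀ ω, (W ω : ℂ) * (Q.eval (t ω : ℂ) * (t ω : ℂ) ^ k) =
        ∑ i ∈ Finset.range N, Q.coeff i * ((W ω * t ω ^ (i + k) : ℝ) : ℂ) := by
      intro ω
      rw [eval_eq_sum_range' hN, Finset.sum_mul, Finset.mul_sum]
      refine Finset.sum_congr rfl fun i _ => ?_
      push_cast
      ring
    simp only [hexp]
    rw [integral_finsetSum _ fun i _ => (integrable_complex_ofReal (hint (i + k))).const_mul _]
    refine Finset.sum_congr rfl fun i _ => ?_
    rw [integral_const_mul, integral_complex_ofReal]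
  have hexp : ∀ ω, (W ω : ℂ) * (Q.eval (t ω : ℂ) * R.eval (t ω : ℂ)) =
      ∑ k ∈ Finset.range d, R.coeff k * ((W ω : ℂ) * (Q.eval (t ω : ℂ) * (t ω : ℂ) ^ k)) := by
    intro ω
    rw [eval_eq_sum_range' hRd, Finset.mul_sum, Finset.mul_sum]
    refine Finset.sum_congr rfl fun i _ => ?_
    ring
  simp only [hexp]
  rw [integral_finsetSum]
  · refine Finset.sum_eq_zero fun k hk => ?_
    rw [integral_const_mul, hpow k (Finset.mem_range.1 hk), mul_zero]
  · intro k _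
    simpa using! (integrable_weight_mul_eval_mul_eval hint Q (X ^ k)).const_mul (R.coeff k)

lemma eval_map_conj_ofReal (R : ℂ[X]) (x : ℝ) :
    (R.map (starRingEnd ℂ)).eval (x : ℂ) = starRingEnd ℂ (R.eval (x : ℂ)) := by
  rw [eval_map, ← eval₂_at_apply, Complex.conj_ofReal]

lemma integrable_weight_mul_normSq (hint : ∀ i : ℕ, Integrable (fun ω => W ω * t ω ^ i) m)
    (R : ℂ[X]) : Integrable (fun ω => W ω * Complex.normSq (R.eval (t ω : ℂ))) m := by
  refine (integrable_weight_mul_eval_mul_eval hint R (R.map (starRingEnd ℂ))).re.congr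
    (ae_of_all _ fun ω => ?_)
  simp only [eval_map_conj_ofReal, Complex.mul_conj, ← Complex.ofReal_mul]
  simp

lemma integral_weight_mul_normSq_pos (hint : ∀ i : ℕ, Integrable (fun ω => W ω * t ω ^ i) m)
    (hW : ∀ᵐ ω ∂m, 0 < W ω) (hfin : ∀ S : Set ℝ, S.Finite → ¬ ∀ᵐ ω ∂m, t ω ∈ S)
    {R : ℂ[X]} (hR : R ≠ 0) :
    0 < ∫ ω, W ω * Complex.normSq (R.eval (t ω : ℂ)) ∂m := by
  have hnn : 0 ≤ᵐ[m] fun ω => W ω * Complex.normSq (R.eval (t ω : ℂ)) := by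
    filter_upwards [hW] with ω hω using mul_nonneg hω.le (Complex.normSq_nonneg _)
  refine lt_of_le_of_ne (integral_nonneg_of_ae hnn) fun h0 => ?_
  have hae := (integral_eq_zero_iff_of_nonneg_ae hnn (integrable_weight_mul_normSq hint R)).1 h0.symm
  refine hfin {x : ℝ | R.IsRoot (x : ℂ)} ?_ ?_
  · exact (finite_setOfPred_isRoot hR).preimage Complex.ofReal_injective.injOn
  · filter_upwards [hW, hae] with ω hω h
    exact Complex.normSq_eq_zero.1 ((mul_eq_zero.1 h).resolve_left hω.ne')

lemma eq_zero_of_orthogonal (hint : ∀ i : ℕ, Integrable (fun ω => W ω * t ω ^ i) m)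
    (hW : ∀ᵐ ω ∂m, 0 < W ω) (hfin : ∀ S : Set ℝ, S.Finite → ¬ ∀ᵐ ω ∂m, t ω ∈ S)
    {Q : ℂ[X]} {N d : ℕ} (hN : Q.natDegree < N)
    (horth : ∀ k < d, ∑ i ∈ Finset.range N,
      Q.coeff i * ((∫ ω, W ω * t ω ^ (i + k) ∂m : ℝ) : ℂ) = 0)
    (hQ : Q.degree < d) : Q = 0 := by
  by_contra hQ0
  have h := integral_weight_mul_eval_mul_eval_eq_zero hint hN horth
    (R := Q.map (starRingEnd ℂ)) (by rwa [degree_map])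
  simp only [eval_map_conj_ofReal, Complex.mul_conj, ← Complex.ofReal_mul] at h
  rw [integral_complex_ofReal, Complex.ofReal_eq_zero] at h
  exact (integral_weight_mul_normSq_pos hint hW hfin hQ0).ne' h

lemma root_nonpos_of_orthogonal (hint : ∀ i : ℕ, Integrable (fun ω => W ω * t ω ^ i) m)
    (hW : ∀ᵐ ω ∂m, 0 < W ω) (ht : ∀ᵐ ω ∂m, t ω ≤ 0)
    (hfin : ∀ S : Set ℝ, S.Finite → ¬ ∀ᵐ ω ∂m, t ω ∈ S)
    {Q : ℂ[X]} {N d : ℕ} (hN : Q.natDegree < N)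
    (horth : ∀ k < d, ∑ i ∈ Finset.range N,
      Q.coeff i * ((∫ ω, W ω * t ω ^ (i + k) ∂m : ℝ) : ℂ) = 0)
    (hQ0 : Q ≠ 0) (hQ : Q.natDegree ≤ d) {z : ℂ} (hz : Q.IsRoot z) :
    ∃ r : ℝ, r ≤ 0 ∧ z = r := by
  obtain ⟨R, rfl⟩ := dvd_iff_isRoot.2 hz
  have hR0 : R ≠ 0 := right_ne_zero_of_mul hQ0
  have hRd : R.degree < d := by
    rw [← natDegree_lt_iff_degree_lt hR0]
    rw [natDegree_mul (X_sub_C_ne_zero z) hR0, natDegree_X_sub_C] at hQ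
    lia
  have h := integral_weight_mul_eval_mul_eval_eq_zero hint hN horth
    (R := R.map (starRingEnd ℂ)) (by rwa [degree_map])
  have hexp : ∀ ω, (W ω : ℂ) * (((X - C z) * R).eval (t ω : ℂ) *
      (R.map (starRingEnd ℂ)).eval (t ω : ℂ)) =
      ((t ω * (W ω * Complex.normSq (R.eval (t ω : ℂ))) : ℝ) : ℂ) -
        z * ((W ω * Complex.normSq (R.eval (t ω : ℂ)) : ℝ) : ℂ) := by
    intro ω
    rw [eval_map_conj_ofReal, eval_mul, mul_assoc, Complex.mul_conj]
    simp only [eval_sub, eval_X, eval_C]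
    push_cast
    ring
  have hb := integral_weight_mul_normSq_pos hint hW hfin hR0
  have hi := integrable_weight_mul_normSq hint R
  have hti : Integrable (fun ω => t ω * (W ω * Complex.normSq (R.eval (t ω : ℂ)))) m := by
    refine (integrable_weight_mul_eval_mul_eval hint (X * R) (R.map (starRingEnd ℂ))).re.congr
      (ae_of_all _ fun ω => ?_)
    simp only [eval_map_conj_ofReal, eval_mul, mul_assoc, Complex.mul_conj, eval_X,
      ← Complex.ofReal_mul]
    simp
    ring
  simp only [hexp] at h
  rw [integral_sub (integrable_complex_ofReal hti)
    ((integrable_complex_ofReal hi).const_mul z), integral_const_mul,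
    integral_complex_ofReal, integral_complex_ofReal] at h
  set a := ∫ ω, t ω * (W ω * Complex.normSq (R.eval (t ω : ℂ))) ∂m with ha
  set b := ∫ ω, W ω * Complex.normSq (R.eval (t ω : ℂ)) ∂m with hb'
  have ha0 : a ≤ 0 := by
    refine integral_nonpos_of_ae ?_
    filter_upwards [hW, ht] with ω hω hω'
    exact mul_nonpos_of_nonpos_of_nonneg hω' (mul_nonneg hω.le (Complex.normSq_nonneg _))
  refine ⟨a / b, div_nonpos_of_nonpos_of_nonneg ha0 hb.le, ?_⟩
  have hbC : (b : ℂ) ≠ 0 := by exact_mod_cast hb.ne'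
  push_cast
  rw [eq_div_iff hbC]
  linear_combination -h

end WeightedOrthogonality

/-- The density `e^{-x} x^{a-1}` of Euler's integral for `Γ(a)`. -/
def gammaDensity (a x : ℝ) : ℝ := Real.exp (-x) * x ^ (a - 1)

lemma gammaDensity_mul_pow (a : ℝ) (i : ℕ) {x : ℝ} (hx : 0 < x) :
    gammaDensity a x * x ^ i = Real.exp (-x) * x ^ (a + i - 1) := by
  rw [gammaDensity, show a + i - 1 = a - 1 + i by ring, Real.rpow_add hx, Real.rpow_natCast]
  ring

lemma integrable_gammaDensity_mul_pow {a : ℝ} (ha : 0 < a) (i : ℕ) :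
    Integrable (fun x => gammaDensity a x * x ^ i) (volume.restrict (Ioi 0)) := by
  have h := Real.GammaIntegral_convergent (s := a + i) (by positivity)
  exact h.congr_fun (fun x hx => (gammaDensity_mul_pow a i hx).symm) measurableSet_Ioi

lemma integral_gammaDensity_mul_pow {a : ℝ} (ha : 0 < a) (i : ℕ) :
    ∫ x in Ioi (0 : ℝ), gammaDensity a x * x ^ i = Real.Gamma (a + i) := by
  rw [Real.Gamma_eq_integral (by positivity)]
  exact setIntegral_congr_fun measurableSet_Ioi fun x hx => gammaDensity_mul_pow a i hx

/-- Lebesgue measure on the open first quadrant. -/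
def quadrantMeasure : Measure (ℝ × ℝ) :=
  (volume.restrict (Ioi (0 : ℝ))).prod (volume.restrict (Ioi (0 : ℝ)))

lemma ae_quadrantMeasure_pos : ∀ᵐ p ∂quadrantMeasure, 0 < p.1 ∧ 0 < p.2 := by
  rw [quadrantMeasure, Measure.prod_restrict,
    ae_restrict_iff' (measurableSet_Ioi.prod measurableSet_Ioi)]
  exact ae_of_all _ fun p hp => ⟨hp.1, hp.2⟩

lemma quadrant_weight_mul_pow (a b : ℝ) (i : ℕ) (p : ℝ × ℝ) :
    gammaDensity a p.1 * gammaDensity b p.2 * (-4 * (p.1 * p.2)) ^ i =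
      (-4) ^ i * ((gammaDensity a p.1 * p.1 ^ i) * (gammaDensity b p.2 * p.2 ^ i)) := by
  rw [mul_pow, mul_pow]
  ring

lemma integrable_quadrant_moment {a b : ℝ} (ha : 0 < a) (hb : 0 < b) (i : ℕ) :
    Integrable (fun p : ℝ × ℝ => gammaDensity a p.1 * gammaDensity b p.2 * (-4 * (p.1 * p.2)) ^ i)
      quadrantMeasure := by
  simp only [quadrant_weight_mul_pow]
  exact ((integrable_gammaDensity_mul_pow ha i).mul_prod
    (integrable_gammaDensity_mul_pow hb i)).const_mul _

lemma integral_quadrant_moment {a b : ℝ} (ha : 0 < a) (hb : 0 < b) (i : ℕ) :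
    ∫ p : ℝ × ℝ, gammaDensity a p.1 * gammaDensity b p.2 * (-4 * (p.1 * p.2)) ^ i
      ∂quadrantMeasure = (-4) ^ i * (Real.Gamma (a + i) * Real.Gamma (b + i)) := by
  simp only [quadrant_weight_mul_pow]
  rw [integral_const_mul, quadrantMeasure,
    integral_prod_mul (fun x => gammaDensity a x * x ^ i) (fun y => gammaDensity b y * y ^ i),
    integral_gammaDensity_mul_pow ha, integral_gammaDensity_mul_pow hb]

lemma ae_quadrant_weight_pos (a b : ℝ) :
    ∀ᵐ p ∂quadrantMeasure, 0 < gammaDensity a p.1 * gammaDensity b p.2 := by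
  filter_upwards [ae_quadrantMeasure_pos] with p hp
  have h1 := Real.rpow_pos_of_pos hp.1 (a - 1)
  have h2 := Real.rpow_pos_of_pos hp.2 (b - 1)
  unfold gammaDensity
  positivity

lemma ae_quadrant_node_nonpos : ∀ᵐ p ∂quadrantMeasure, -4 * (p.1 * p.2) ≤ 0 := by
  filter_upwards [ae_quadrantMeasure_pos] with p hp
  nlinarith [mul_pos hp.1 hp.2]

lemma not_ae_quadrant_node_mem {S : Set ℝ} (hS : S.Finite) :
    ¬ ∀ᵐ p ∂quadrantMeasure, -4 * (p.1 * p.2) ∈ S := by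
  intro h
  have : NeZero (volume.restrict (Ioi (0 : ℝ))) := ⟨by simp⟩
  have h1 : ∀ᵐ x ∂volume.restrict (Ioi (0 : ℝ)), ∀ᵐ y ∂volume.restrict (Ioi (0 : ℝ)),
      -4 * (x * y) ∈ S := Measure.ae_ae_of_ae_prod h
  obtain ⟨x, hx, hx0⟩ := (h1.and (ae_restrict_mem measurableSet_Ioi)).exists
  have hx0' : x ≠ 0 := (mem_Ioi.1 hx0).ne'
  have hfin : {y : ℝ | -4 * (x * y) ∈ S}.Finite :=
    hS.preimage fun y _ y' _ hyy => mul_left_cancel₀ hx0' (by simpa using hyy)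
  have h2 : ∀ᵐ y ∂volume.restrict (Ioi (0 : ℝ)), y ∉ {y : ℝ | -4 * (x * y) ∈ S} :=
    measure_eq_zero_iff_ae_notMem.1 (hfin.measure_zero _)
  obtain ⟨y, hy, hy'⟩ := (hx.and h2).exists
  exact hy' hy

lemma besselMoment_add_two_mul {ν : ℝ} {M : ℕ} (h : 0 < 2 * ν + M + 1) (r : ℕ) :
    besselMoment ν (M + 2 * r) =
      besselMoment ν M / (Real.Gamma ((M + 1) / 2) * Real.Gamma (ν + (M + 1) / 2)) *
        ((-4) ^ r * (Real.Gamma ((M + 1) / 2 + r) * Real.Gamma (ν + (M + 1) / 2 + r))) := by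
  have ha : (0 : ℝ) < ((M : ℝ) + 1) / 2 := by positivity
  have hb : 0 < ν + ((M : ℝ) + 1) / 2 := by linarith
  induction r with
  | zero =>
    have h1 := (Real.Gamma_pos_of_pos ha).ne'
    have h2 := (Real.Gamma_pos_of_pos hb).ne'
    simp only [mul_zero, add_zero, pow_zero, one_mul, Nat.cast_zero]
    exact (div_mul_cancel₀ _ (mul_ne_zero h1 h2)).symm
  | succ r ih =>
    have hr : (0 : ℝ) ≤ r := r.cast_nonneg
    rw [show M + 2 * (r + 1) = M + 2 * r + 2 by ring,
      besselMoment_add_two (by push_cast; linarith), ih]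
    push_cast
    rw [← add_assoc ((M + 1 : ℝ) / 2), ← add_assoc (ν + (M + 1 : ℝ) / 2),
      Real.Gamma_add_one (by positivity), Real.Gamma_add_one (by positivity)]
    ring

lemma sum_moment_of_sum_besselMoment {ν : ℝ} {M : ℕ} (h : 0 < 2 * ν + M + 1) (he : Even M)
    {Q : ℂ[X]} {N d : ℕ}
    (horth : ∀ k < d, ∑ i ∈ Finset.range N,
      Q.coeff i * (besselMoment ν (M + 2 * (i + k)) : ℂ) = 0) :
    ∀ k < d, ∑ i ∈ Finset.range N, Q.coeff i * ((∫ p : ℝ × ℝ,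
      gammaDensity ((M + 1) / 2) p.1 * gammaDensity (ν + (M + 1) / 2) p.2 *
        (-4 * (p.1 * p.2)) ^ (i + k) ∂quadrantMeasure : ℝ) : ℂ) = 0 := by
  have ha : (0 : ℝ) < ((M : ℝ) + 1) / 2 := by positivity
  have hb : 0 < ν + ((M : ℝ) + 1) / 2 := by linarith
  intro k hk
  have h0 := horth k hk
  simp only [besselMoment_add_two_mul h, ← integral_quadrant_moment ha hb, Complex.ofReal_mul,
    mul_left_comm (Q.coeff _)] at h0
  rw [← Finset.mul_sum] at h0
  refine (mul_eq_zero.1 h0).resolve_left (Complex.ofReal_ne_zero.2 (div_ne_zero ?_ ?_))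
  · exact (besselMoment_spec h).2.2 he
  · exact (mul_pos (Real.Gamma_pos_of_pos ha) (Real.Gamma_pos_of_pos hb)).ne'

lemma eq_zero_of_sum_besselMoment {ν : ℝ} {M : ℕ} (h : 0 < 2 * ν + M + 1) (he : Even M)
    {Q : ℂ[X]} {N d : ℕ} (hN : Q.natDegree < N)
    (horth : ∀ k < d, ∑ i ∈ Finset.range N,
      Q.coeff i * (besselMoment ν (M + 2 * (i + k)) : ℂ) = 0)
    (hQ : Q.degree < d) : Q = 0 :=
  eq_zero_of_orthogonal
    (integrable_quadrant_moment (by positivity) (by linarith)) (ae_quadrant_weight_pos _ _)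
    (fun _ => not_ae_quadrant_node_mem) hN (sum_moment_of_sum_besselMoment h he horth) hQ

lemma root_nonpos_of_sum_besselMoment {ν : ℝ} {M : ℕ} (h : 0 < 2 * ν + M + 1) (he : Even M)
    {Q : ℂ[X]} {N d : ℕ} (hN : Q.natDegree < N)
    (horth : ∀ k < d, ∑ i ∈ Finset.range N,
      Q.coeff i * (besselMoment ν (M + 2 * (i + k)) : ℂ) = 0)
    (hQ0 : Q ≠ 0) (hQ : Q.natDegree ≤ d) {z : ℂ} (hz : Q.IsRoot z) : ∃ r : ℝ, r ≤ 0 ∧ z = r :=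
  root_nonpos_of_orthogonal
    (integrable_quadrant_moment (by positivity) (by linarith)) (ae_quadrant_weight_pos _ _)
    ae_quadrant_node_nonpos (fun _ => not_ae_quadrant_node_mem) hN
    (sum_moment_of_sum_besselMoment h he horth) hQ0 hQ hz

lemma MonicOrthoBessel.sum_besselMoment {μ ν : ℝ} {m D : ℕ} (h1 : -1 < μ + ν) (hm : μ - ν = m)
    {P : ℂ[X]} (hP : MonicOrthoBessel μ ν D P) {N : ℕ} (hN : P.natDegree < N) {k : ℕ}
    (hk : k < D) :
    ∑ l ∈ Finset.range N, P.coeff l * (besselMoment ν (m + (l + k)) : ℂ) = 0 := by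
  have hpos : ∀ l : ℕ, 0 < 2 * ν + (m + (l + k) : ℕ) + 1 := by
    intro l
    have hl : (0 : ℝ) ≤ l := l.cast_nonneg
    have hk' : (0 : ℝ) ≤ k := k.cast_nonneg
    push_cast
    linarith
  have hlim := (hP.2.2 k hk).2
  have hval : ∀ s : ℝ, 0 < s →
      ∫ x in Ioi (0 : ℝ), Complex.exp (-(s : ℂ) * (x : ℂ)) *
        (P.eval (x : ℂ) * ((x ^ ((k : ℝ) + μ) : ℝ) : ℂ) * (besselJ ν x : ℂ)) =
      (((2 : ℝ) ^ (-ν) : ℝ) : ℂ) * ∑ l ∈ Finset.range N,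
        P.coeff l * (besselLaplace (2 * ν + (m + (l + k) : ℕ)) ν s : ℂ) := by
    intro s hs
    have hexp : ∀ x ∈ Ioi (0 : ℝ), Complex.exp (-(s : ℂ) * (x : ℂ)) *
        (P.eval (x : ℂ) * ((x ^ ((k : ℝ) + μ) : ℝ) : ℂ) * (besselJ ν x : ℂ)) =
        (((2 : ℝ) ^ (-ν) : ℝ) : ℂ) * ∑ l ∈ Finset.range N, P.coeff l *
          ((Real.exp (-s * x) *
            (x ^ (2 * ν + (m + (l + k) : ℕ)) * besselEntire ν x) : ℝ) : ℂ) := by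
      intro x hx
      have hx0 : 0 < x := hx
      rw [besselJ_eq ν hx0, eval_eq_sum_range' hN, Finset.sum_mul, Finset.sum_mul,
        Finset.mul_sum, Finset.mul_sum]
      refine Finset.sum_congr rfl fun l _ => ?_
      have hpow : x ^ (2 * ν + ((m + (l + k) : ℕ) : ℝ)) = x ^ l * x ^ ((k : ℝ) + μ) * x ^ ν := by
        rw [← Real.rpow_natCast x l, ← Real.rpow_add hx0, ← Real.rpow_add hx0]
        congr 1
        push_cast
        linarith
      rw [hpow, Real.div_rpow hx0.le zero_le_two, div_eq_mul_inv, ← Real.rpow_neg zero_le_two]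
      push_cast
      ring
    rw [setIntegral_congr_fun measurableSet_Ioi hexp, integral_const_mul, integral_finsetSum]
    · congr 1
      refine Finset.sum_congr rfl fun l _ => ?_
      rw [integral_const_mul, integral_complex_ofReal, besselLaplace]
    · intro l _
      exact (integrable_complex_ofReal
        (integrableOn_besselLaplace ν (by linarith [hpos l]) hs)).const_mul _
  have hlim' : Tendsto (fun s : ℝ => (((2 : ℝ) ^ (-ν) : ℝ) : ℂ) * ∑ l ∈ Finset.range N,
      P.coeff l * (besselLaplace (2 * ν + (m + (l + k) : ℕ)) ν s : ℂ)) (𝓝[>] 0)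
      (𝓝 ((((2 : ℝ) ^ (-ν) : ℝ) : ℂ) * ∑ l ∈ Finset.range N,
        P.coeff l * (besselMoment ν (m + (l + k)) : ℂ))) := by
    refine (tendsto_finsetSum _ fun l _ => ?_).const_mul _
    exact ((Complex.continuous_ofReal.tendsto _).comp (besselMoment_spec (hpos l)).1).const_mul _
  have hzero := tendsto_nhds_unique hlim' (hlim.congr' (by
    filter_upwards [self_mem_nhdsWithin] with s hs using hval s hs))
  refine (mul_eq_zero.1 hzero).resolve_left (Complex.ofReal_ne_zero.2 ?_)
  exact (Real.rpow_pos_of_pos two_pos _).ne'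

lemma Finset.sum_range_two_mul_eq {R : Type*} [AddCommMonoid R] (g : ℕ → R) (N : ℕ) :
    ∑ l ∈ Finset.range (2 * N), g l =
      ∑ i ∈ Finset.range N, g (2 * i) + ∑ i ∈ Finset.range N, g (2 * i + 1) := by
  induction N with
  | zero => simp
  | succ N ih =>
    rw [show 2 * (N + 1) = 2 * N + 1 + 1 by ring, Finset.sum_range_succ, Finset.sum_range_succ, ih,
      Finset.sum_range_succ, Finset.sum_range_succ]
    abel

/-- The polynomial whose coefficients are the even-index coefficients. -/
def evenPart (P : ℂ[X]) : ℂ[X] := contract 2 P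

/-- The polynomial whose coefficients are the odd-index coefficients. -/
def oddPart (P : ℂ[X]) : ℂ[X] := contract 2 P.divX

lemma coeff_evenPart (P : ℂ[X]) (i : ℕ) : (evenPart P).coeff i = P.coeff (2 * i) := by
  rw [evenPart, coeff_contract two_ne_zero, mul_comm]

lemma coeff_oddPart (P : ℂ[X]) (i : ℕ) : (oddPart P).coeff i = P.coeff (2 * i + 1) := by
  rw [oddPart, coeff_contract two_ne_zero, coeff_divX, mul_comm]

lemma degree_evenPart_lt {P : ℂ[X]} {d : ℕ} (h : P.natDegree < 2 * d) :
    (evenPart P).degree < d :=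
  (degree_lt_iff_coeff_zero _ _).2 fun i hi => by
    rw [coeff_evenPart]
    exact coeff_eq_zero_of_natDegree_lt (by lia)

lemma degree_oddPart_lt {P : ℂ[X]} {d : ℕ} (h : P.natDegree < 2 * d + 1) :
    (oddPart P).degree < d :=
  (degree_lt_iff_coeff_zero _ _).2 fun i hi => by
    rw [coeff_oddPart]
    exact coeff_eq_zero_of_natDegree_lt (by lia)

lemma natDegree_evenPart_le (P : ℂ[X]) : (evenPart P).natDegree ≤ P.natDegree / 2 :=
  natDegree_le_iff_coeff_eq_zero.2 fun i hi => by
    rw [coeff_evenPart]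
    exact coeff_eq_zero_of_natDegree_lt (by lia)

lemma natDegree_oddPart_le (P : ℂ[X]) : (oddPart P).natDegree ≤ P.natDegree / 2 :=
  natDegree_le_iff_coeff_eq_zero.2 fun i hi => by
    rw [coeff_oddPart]
    exact coeff_eq_zero_of_natDegree_lt (by lia)

lemma eval_eq_evenPart_add_oddPart (P : ℂ[X]) (x : ℂ) :
    P.eval x = (evenPart P).eval (x ^ 2) + x * (oddPart P).eval (x ^ 2) := by
  have hE := natDegree_evenPart_le P
  have hO := natDegree_oddPart_le P
  rw [eval_eq_sum_range' (n := 2 * (P.natDegree + 1)) (by lia), Finset.sum_range_two_mul_eq,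
    eval_eq_sum_range' (p := evenPart P) (n := P.natDegree + 1) (by lia),
    eval_eq_sum_range' (p := oddPart P) (n := P.natDegree + 1) (by lia), Finset.mul_sum]
  simp only [coeff_evenPart, coeff_oddPart]
  congr 1 <;> refine Finset.sum_congr rfl fun i _ => ?_ <;> ring

section Parity

variable {μ ν : ℝ} {m D : ℕ} {P : ℂ[X]}

lemma MonicOrthoBessel.sum_evenPart (h1 : -1 < μ + ν) (hm : μ - ν = m)
    (hP : MonicOrthoBessel μ ν D P) {k : ℕ} (hk : k < D) (he : Even (m + k)) :
    ∑ i ∈ Finset.range (P.natDegree + 1),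
      (evenPart P).coeff i * (besselMoment ν (m + k + 2 * i) : ℂ) = 0 := by
  have h := hP.sum_besselMoment h1 hm (N := 2 * (P.natDegree + 1)) (by lia) hk
  rw [Finset.sum_range_two_mul_eq, Finset.sum_eq_zero (s := Finset.range _)
    (f := fun i => P.coeff (2 * i + 1) * _), add_zero] at h
  · rw [← h]
    refine Finset.sum_congr rfl fun i _ => ?_
    rw [coeff_evenPart, show m + k + 2 * i = m + (2 * i + k) by ring]
  · intro i _
    have hpos : 0 < 2 * ν + (m + (2 * i + 1 + k) : ℕ) + 1 := by
      have hi : (0 : ℝ) ≤ i := i.cast_nonneg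
      have hk' : (0 : ℝ) ≤ k := k.cast_nonneg
      push_cast
      linarith
    have hodd : Odd (m + (2 * i + 1 + k)) := by
      rw [show m + (2 * i + 1 + k) = m + k + (2 * i + 1) by ring]
      exact he.add_odd (odd_two_mul_add_one i)
    rw [(besselMoment_spec hpos).2.1 hodd, Complex.ofReal_zero, mul_zero]

lemma MonicOrthoBessel.sum_oddPart (h1 : -1 < μ + ν) (hm : μ - ν = m)
    (hP : MonicOrthoBessel μ ν D P) {k : ℕ} (hk : k < D) (ho : Odd (m + k)) :
    ∑ i ∈ Finset.range (P.natDegree + 1),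
      (oddPart P).coeff i * (besselMoment ν (m + k + 1 + 2 * i) : ℂ) = 0 := by
  have h := hP.sum_besselMoment h1 hm (N := 2 * (P.natDegree + 1)) (by lia) hk
  rw [Finset.sum_range_two_mul_eq, Finset.sum_eq_zero (s := Finset.range _)
    (f := fun i => P.coeff (2 * i) * _), zero_add] at h
  · rw [← h]
    refine Finset.sum_congr rfl fun i _ => ?_
    rw [coeff_oddPart, show m + k + 1 + 2 * i = m + (2 * i + 1 + k) by ring]
  · intro i _
    have hpos : 0 < 2 * ν + (m + (2 * i + k) : ℕ) + 1 := by
      have hi : (0 : ℝ) ≤ i := i.cast_nonneg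
      have hk' : (0 : ℝ) ≤ k := k.cast_nonneg
      push_cast
      linarith
    have hodd : Odd (m + (2 * i + k)) := by
      rw [show m + (2 * i + k) = m + k + 2 * i by ring]
      exact ho.add_even (even_two_mul i)
    rw [(besselMoment_spec hpos).2.1 hodd, Complex.ofReal_zero, mul_zero]

/-- If `m + e` is even, the even part is orthogonal with respect to the moments of parity `e`. -/
lemma MonicOrthoBessel.orthogonal_evenPart (h1 : -1 < μ + ν) (hm : μ - ν = m)
    (hP : MonicOrthoBessel μ ν D P) {e d : ℕ} (he : Even (m + e)) (hd : e + 2 * d ≤ D + 1) :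
    ∀ k < d, ∑ i ∈ Finset.range (P.natDegree + 1),
      (evenPart P).coeff i * (besselMoment ν (m + e + 2 * (i + k)) : ℂ) = 0 := by
  intro k hk
  rw [← hP.sum_evenPart h1 hm (k := e + 2 * k) (by lia) (by
    rw [← add_assoc]; exact he.add (even_two_mul k))]
  refine Finset.sum_congr rfl fun i _ => ?_
  rw [show m + e + 2 * (i + k) = m + (e + 2 * k) + 2 * i by ring]

/-- If `m + e` is odd, the odd part is orthogonal with respect to the moments of parity `e`. -/
lemma MonicOrthoBessel.orthogonal_oddPart (h1 : -1 < μ + ν) (hm : μ - ν = m)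
    (hP : MonicOrthoBessel μ ν D P) {e d : ℕ} (ho : Odd (m + e)) (hd : e + 2 * d ≤ D + 1) :
    ∀ k < d, ∑ i ∈ Finset.range (P.natDegree + 1),
      (oddPart P).coeff i * (besselMoment ν (m + e + 1 + 2 * (i + k)) : ℂ) = 0 := by
  intro k hk
  rw [← hP.sum_oddPart h1 hm (k := e + 2 * k) (by lia) (by
    rw [← add_assoc]; exact ho.add_even (even_two_mul k))]
  refine Finset.sum_congr rfl fun i _ => ?_
  rw [show m + e + 1 + 2 * (i + k) = m + (e + 2 * k) + 1 + 2 * i by ring]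

lemma Complex.re_eq_zero_of_sq_eq_nonpos {z : ℂ} {r : ℝ} (hr : r ≤ 0) (h : z ^ 2 = r) :
    z.re = 0 := by
  have h2 := congrArg Complex.re h
  have h3 := congrArg Complex.im h
  simp only [sq, Complex.mul_re, Complex.mul_im, Complex.ofReal_re, Complex.ofReal_im] at h2 h3
  rcases mul_eq_zero.1 (show z.re * z.im = 0 by linarith) with h0 | h0
  · exact h0
  · rw [h0] at h2
    nlinarith [mul_self_nonneg z.re, mul_self_eq_zero.1 (show z.re * z.re = 0 by
      nlinarith [mul_self_nonneg z.re])]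

lemma MonicOrthoBessel.even_degree (h1 : -1 < μ + ν) (hm : μ - ν = m) {n : ℕ}
    (hP : MonicOrthoBessel μ ν (2 * n) P) :
    (∀ x : ℂ, P.eval x = (evenPart P).eval (x ^ 2)) ∧ ∀ z : ℂ, P.IsRoot z → z.re = 0 := by
  have hdeg : P.natDegree = 2 * n := hP.2.1
  obtain ⟨e, e', he, he', hle, hle'⟩ : ∃ e e' : ℕ, Even (m + e) ∧ Odd (m + e') ∧ e ≤ 1 ∧ e' ≤ 1 := by
    rcases Nat.even_or_odd m with h | h
    · exact ⟨0, 1, h, h.add_one, by lia, by lia⟩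
    · exact ⟨1, 0, h.add_one, h, by lia, by lia⟩
  have hpos : ∀ j : ℕ, 0 < 2 * ν + (m + j : ℕ) + 1 := fun j => by
    have hj : (0 : ℝ) ≤ j := j.cast_nonneg
    push_cast
    linarith
  have hE := natDegree_evenPart_le P
  have hO := natDegree_oddPart_le P
  have hodd : oddPart P = 0 :=
    eq_zero_of_sum_besselMoment (hpos (e' + 1)) he'.add_one (N := P.natDegree + 1) (by lia)
      (hP.orthogonal_oddPart h1 hm he' (d := n) (by lia)) (degree_oddPart_lt (by lia))
  have heval : ∀ x : ℂ, P.eval x = (evenPart P).eval (x ^ 2) := fun x => by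
    rw [eval_eq_evenPart_add_oddPart, hodd, eval_zero, mul_zero, add_zero]
  have hne : evenPart P ≠ 0 := fun h0 => by
    have := coeff_evenPart P n
    rw [h0, coeff_zero, ← hdeg, hP.1.coeff_natDegree] at this
    exact zero_ne_one this
  refine ⟨heval, fun z hz => ?_⟩
  obtain ⟨r, hr, hzr⟩ := root_nonpos_of_sum_besselMoment (hpos e) he (N := P.natDegree + 1)
    (by lia) (hP.orthogonal_evenPart h1 hm he (d := n) (by lia)) hne (by lia)
    (z := z ^ 2) ((heval z).symm.trans hz)
  exact Complex.re_eq_zero_of_sq_eq_nonpos hr hzr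

lemma MonicOrthoBessel.odd_degree (h1 : -1 < μ + ν) (hm : μ - ν = m) (hme : Even m) {n : ℕ}
    (hP : MonicOrthoBessel μ ν (2 * n + 1) P) :
    (∀ x : ℂ, P.eval x = x * (oddPart P).eval (x ^ 2)) ∧ ∀ z : ℂ, P.IsRoot z → z.re = 0 := by
  have hdeg : P.natDegree = 2 * n + 1 := hP.2.1
  have hpos : ∀ j : ℕ, 0 < 2 * ν + (m + j : ℕ) + 1 := fun j => by
    have hj : (0 : ℝ) ≤ j := j.cast_nonneg
    push_cast
    linarith
  have hE := natDegree_evenPart_le P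
  have hO := natDegree_oddPart_le P
  have heven : evenPart P = 0 :=
    eq_zero_of_sum_besselMoment (hpos 0) hme (N := P.natDegree + 1) (by lia)
      (hP.orthogonal_evenPart h1 hm (e := 0) (d := n + 1) hme (by lia))
      (degree_evenPart_lt (by lia))
  have heval : ∀ x : ℂ, P.eval x = x * (oddPart P).eval (x ^ 2) := fun x => by
    rw [eval_eq_evenPart_add_oddPart, heven, eval_zero, zero_add]
  have hne : oddPart P ≠ 0 := fun h0 => by
    have := coeff_oddPart P n
    rw [h0, coeff_zero, ← hdeg, hP.1.coeff_natDegree] at this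
    exact zero_ne_one this
  refine ⟨heval, fun z hz => ?_⟩
  rcases mul_eq_zero.1 ((heval z).symm.trans hz) with h0 | h0
  · simp [h0]
  · obtain ⟨r, hr, hzr⟩ := root_nonpos_of_sum_besselMoment (hpos 2) (hme.add even_two)
      (N := P.natDegree + 1) (by lia)
      (hP.orthogonal_oddPart h1 hm (e := 1) (d := n) hme.add_one (by lia)) hne (by lia)
      (z := z ^ 2) h0
    exact Complex.re_eq_zero_of_sq_eq_nonpos hr hzr

end Parity

/-- parity and zero location of orthogonal polynomials for `x^μ J_ν(x)`. -/
theorem ortho_parity_and_roots (μ ν : ℝ) (h1 : -1 < μ + ν)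
    (hint : ∃ m : ℕ, μ - ν = m) (n : ℕ) :
    (∀ P : Polynomial ℂ, MonicOrthoBessel μ ν (2 * n) P →
      (∀ x : ℂ, P.eval (-x) = P.eval x) ∧
      (∀ z : ℂ, P.IsRoot z → z.re = 0) ∧
      (∀ z : ℂ, P.IsRoot z → P.IsRoot (starRingEnd ℂ z))) ∧
    ((∃ m : ℕ, μ - ν = 2 * m) →
      ∀ P : Polynomial ℂ, MonicOrthoBessel μ ν (2 * n + 1) P →
        (∀ x : ℂ, P.eval (-x) = -P.eval x) ∧
        (∀ z : ℂ, P.IsRoot z → z.re = 0)) := by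
  obtain ⟨m, hm⟩ := hint
  refine ⟨fun P hP => ?_, fun ⟨q, hq⟩ P hP => ?_⟩
  · obtain ⟨heval, hroot⟩ := hP.even_degree h1 hm
    have heven : ∀ x : ℂ, P.eval (-x) = P.eval x := fun x => by rw [heval, heval, neg_sq]
    refine ⟨heven, hroot, fun z hz => ?_⟩
    have hconj : starRingEnd ℂ z = -z := by
      apply Complex.ext <;> simp [hroot z hz]
    rw [hconj]
    exact (heven z).trans hz
  · obtain ⟨heval, hroot⟩ := hP.odd_degree h1 (m := 2 * q) (by push_cast; exact hq)
      (even_two_mul q)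
    exact ⟨fun x => by rw [heval, heval, neg_sq, neg_mul], hroot⟩

end
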